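/- Let S be a locally compact, σ-compact topological ternary semigroup and ρ a closed congruence on S. Then the quotient S/ρ, with the induced ternary multiplication (aρ)(bρ)(cρ) = (abc)ρ and the quotient topology, is a topological ternary semigroup: S/ρ is Hausdorff and the induced ternary multiplication is continuous. -/

import Mathlib

open Topology

/-- If the kernel of `f` is closed, then the saturation of a compact set is closed. -/
theorem isClosed_preimage_image_of_isCompact {X X' : Type*} [TopologicalSpace X] {f : X → X'}
    (hf : IsClosed {p : X × X | f p.1 = f p.2}) {A : Set X} (hA : IsCompact A) :
    IsClosed (f ⁻¹' (f '' A)) := by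
  have := isCompact_iff_compactSpace.mp hA
  have hcl : IsClosed {p : A × X | f p.1 = f p.2} :=
    hf.preimage (by fun_prop : Continuous fun p : A × X => ((p.1 : X), p.2))
  convert isClosedMap_snd_of_compactSpace _ hcl using 1
  ext y
  simp

/-- In a saturated open subset of a product, a compact box can be enlarged to a compact box whose
sides are neighbourhoods of the original sides and of their saturations within given compact
sets. -/
theorem exists_compact_box_enlargement {X X' Y Y' : Type*}
    [TopologicalSpace X] [LocallyCompactSpace X] [TopologicalSpace Y] [LocallyCompactSpace Y]
    {f : X → X'} (hf : IsClosed {p : X × X | f p.1 = f p.2})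
    {g : Y → Y'} (hg : IsClosed {p : Y × Y | g p.1 = g p.2})
    {W : Set (X' × Y')} (hW : IsOpen (Prod.map f g ⁻¹' W))
    {K : Set X} (hK : IsCompact K) {L : Set Y} (hL : IsCompact L)
    {A : Set X} (hA : IsCompact A) {B : Set Y} (hB : IsCompact B)
    (hAB : A ×ˢ B ⊆ Prod.map f g ⁻¹' W) :
    ∃ (A₁ : Set X) (B₁ : Set Y), IsCompact A₁ ∧ IsCompact B₁ ∧
      A₁ ×ˢ B₁ ⊆ Prod.map f g ⁻¹' W ∧
      A ∪ K ∩ f ⁻¹' (f '' A) ⊆ interior A₁ ∧ B ∪ L ∩ g ⁻¹' (g '' B) ⊆ interior B₁ := by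
  have hA' : IsCompact (A ∪ K ∩ f ⁻¹' (f '' A)) :=
    hA.union (hK.inter_right (isClosed_preimage_image_of_isCompact hf hA))
  have hB' : IsCompact (B ∪ L ∩ g ⁻¹' (g '' B)) :=
    hB.union (hL.inter_right (isClosed_preimage_image_of_isCompact hg hB))
  have hsub : (A ∪ K ∩ f ⁻¹' (f '' A)) ×ˢ (B ∪ L ∩ g ⁻¹' (g '' B)) ⊆ Prod.map f g ⁻¹' W := by
    rintro ⟨x, y⟩ ⟨hx, hy⟩
    obtain ⟨a, ha, hax⟩ : ∃ a ∈ A, f a = f x := hx.elim (fun h => ⟨x, h, rfl⟩) (fun h => h.2)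
    obtain ⟨b, hb, hby⟩ : ∃ b ∈ B, g b = g y := hy.elim (fun h => ⟨y, h, rfl⟩) (fun h => h.2)
    have hab := hAB (Set.mk_mem_prod ha hb)
    simpa [hax, hby] using hab
  obtain ⟨U, V, hU, hV, hAU, hBV, hUV⟩ := generalized_tube_lemma hA' hB' hW hsub
  obtain ⟨A₁, hA₁, hAA₁, hA₁U⟩ := exists_compact_between hA' hU hAU
  obtain ⟨B₁, hB₁, hBB₁, hB₁V⟩ := exists_compact_between hB' hV hBV
  exact ⟨A₁, B₁, hA₁, hB₁, (Set.prod_mono hA₁U hB₁V).trans hUV, hAA₁, hBB₁⟩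

/-- The image, under a quotient map, of the union of an increasing sequence of sets, each of which
is a neighbourhood of the saturation of the previous one within the steps of a compact exhaustion,
is open. -/
theorem Topology.IsQuotientMap.isOpen_image_iUnion_of_compactExhaustion {X X' : Type*}
    [TopologicalSpace X] [TopologicalSpace X'] {f : X → X'} (hf : IsQuotientMap f)
    (K : CompactExhaustion X) {A : ℕ → Set X}
    (hA : ∀ n, A n ∪ K n ∩ f ⁻¹' (f '' A n) ⊆ interior (A (n + 1))) :
    IsOpen (f '' ⋃ n, A n) := by
  have hsucc (n : ℕ) : A n ⊆ interior (A (n + 1)) := Set.subset_union_left.trans (hA n)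
  have hmono : Monotone A := monotone_nat_of_le_succ fun n => (hsucc n).trans interior_subset
  rw [← hf.isOpen_preimage, isOpen_iff_mem_nhds]
  rintro y ⟨x, hx, hxy⟩
  obtain ⟨n, hn⟩ := Set.mem_iUnion.mp hx
  obtain ⟨k, hk⟩ := K.exists_mem y
  have hy : y ∈ interior (A (max n k + 1)) :=
    hA _ (Or.inr ⟨K.subset (le_max_right n k) hk, x, hmono (le_max_left n k) hn, hxy⟩)
  exact Filter.mem_of_superset (mem_interior_iff_mem_nhds.mp hy)
    ((Set.subset_iUnion A _).trans (Set.subset_preimage_image f _))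

/-- The product of two quotient maps with closed kernels on locally compact, σ-compact spaces is a
quotient map. -/
theorem Topology.IsQuotientMap.prodMap_of_isClosed_ker {X X' Y Y' : Type*}
    [TopologicalSpace X] [LocallyCompactSpace X] [SigmaCompactSpace X] [TopologicalSpace X']
    [TopologicalSpace Y] [LocallyCompactSpace Y] [SigmaCompactSpace Y] [TopologicalSpace Y']
    {f : X → X'} (hf : IsQuotientMap f) (hfc : IsClosed {p : X × X | f p.1 = f p.2})
    {g : Y → Y'} (hg : IsQuotientMap g) (hgc : IsClosed {p : Y × Y | g p.1 = g p.2}) :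
    IsQuotientMap (Prod.map f g) := by
  refine ⟨.of_isOpen_preimage_iff_isOpen fun W => ⟨fun hW => ?_,
    fun hW => hW.preimage (hf.continuous.prodMap hg.continuous)⟩,
    hf.surjective.prodMap hg.surjective⟩
  rw [isOpen_prod_iff]
  intro x' y' hxy
  obtain ⟨x, rfl⟩ := hf.surjective x'
  obtain ⟨y, rfl⟩ := hg.surjective y'
  let K := CompactExhaustion.choice X
  let L := CompactExhaustion.choice Y
  let Box := {P : Set X × Set Y //
    IsCompact P.1 ∧ IsCompact P.2 ∧ P.1 ×ˢ P.2 ⊆ Prod.map f g ⁻¹' W}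
  have step (n : ℕ) (P : Box) : ∃ Q : Box,
      P.1.1 ∪ K n ∩ f ⁻¹' (f '' P.1.1) ⊆ interior Q.1.1 ∧
      P.1.2 ∪ L n ∩ g ⁻¹' (g '' P.1.2) ⊆ interior Q.1.2 := by
    obtain ⟨A, B, hA, hB, hAB, hPA, hPB⟩ := exists_compact_box_enlargement hfc hgc hW
      (K.isCompact n) (L.isCompact n) P.2.1 P.2.2.1 P.2.2.2
    exact ⟨⟨(A, B), hA, hB, hAB⟩, hPA, hPB⟩
  choose next hnext using step
  let P : ℕ → Box := fun n => Nat.rec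
    ⟨({x}, {y}), isCompact_singleton, isCompact_singleton, by simpa using hxy⟩ next n
  have hP₁ (n : ℕ) := (hnext n (P n)).1
  have hP₂ (n : ℕ) := (hnext n (P n)).2
  have mono₁ : Monotone fun n => (P n).1.1 := monotone_nat_of_le_succ fun n =>
    (Set.subset_union_left.trans (hP₁ n)).trans interior_subset
  have mono₂ : Monotone fun n => (P n).1.2 := monotone_nat_of_le_succ fun n =>
    (Set.subset_union_left.trans (hP₂ n)).trans interior_subset
  refine ⟨_, _, hf.isOpen_image_iUnion_of_compactExhaustion K (A := fun n => (P n).1.1) hP₁,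
    hg.isOpen_image_iUnion_of_compactExhaustion L (A := fun n => (P n).1.2) hP₂,
    ⟨x, Set.mem_iUnion.mpr ⟨0, rfl⟩, rfl⟩, ⟨y, Set.mem_iUnion.mpr ⟨0, rfl⟩, rfl⟩, ?_⟩
  rintro ⟨_, _⟩ ⟨⟨a, ha, rfl⟩, ⟨b, hb, rfl⟩⟩
  obtain ⟨i, hi⟩ := Set.mem_iUnion.mp ha
  obtain ⟨j, hj⟩ := Set.mem_iUnion.mp hb
  exact (P (max i j)).2.2.2
    (Set.mk_mem_prod (mono₁ (le_max_left i j) hi) (mono₂ (le_max_right i j) hj))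

/-- Let `S` be a locally compact, σ-compact topological ternary
semigroup and `s` a closed congruence on `S`.  Then `S/s` with the induced ternary
multiplication and the quotient topology is a topological ternary semigroup: it is
Hausdorff and the induced ternary multiplication is continuous. -/
theorem quotient_topological_ternary_semigroup_of_locallyCompact_sigmaCompact {S : Type*}
    [TopologicalSpace S] [T2Space S] [LocallyCompactSpace S] [SigmaCompactSpace S]
    (m : S → S → S → S)
    (hassoc : ∀ a b c d e : S, m (m a b c) d e = m a (m b c d) e ∧
      m a (m b c d) e = m a b (m c d e))
    (hm : Continuous fun p : S × S × S => m p.1 p.2.1 p.2.2)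
    (s : Setoid S)
    (hcong : ∀ a b c d e f : S, s.r a b → s.r c d → s.r e f → s.r (m a c e) (m b d f))
    (hclosed : IsClosed {p : S × S | s.r p.1 p.2})
    (g : Quotient s → Quotient s → Quotient s → Quotient s)
    (hg : ∀ a b c : S, g (Quotient.mk s a) (Quotient.mk s b) (Quotient.mk s c)
      = Quotient.mk s (m a b c)) :
    T2Space (Quotient s) ∧
      Continuous fun p : Quotient s × Quotient s × Quotient s => g p.1 p.2.1 p.2.2 := by
  have hq : IsQuotientMap (Quotient.mk s) := isQuotientMap_quotient_mk'
  have hqc : IsClosed {p : S × S | Quotient.mk s p.1 = Quotient.mk s p.2} := by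
    simpa only [Quotient.eq] using hclosed
  have hq₂ := hq.prodMap_of_isClosed_ker hqc hq hqc
  have hqc₂ : IsClosed {p : (S × S) × (S × S) |
      Prod.map (Quotient.mk s) (Quotient.mk s) p.1 =
        Prod.map (Quotient.mk s) (Quotient.mk s) p.2} := by
    simp only [Prod.ext_iff, Prod.map_fst, Prod.map_snd]
    exact (hqc.preimage (by fun_prop : Continuous fun p : (S × S) × (S × S) =>
      (p.1.1, p.2.1))).inter (hqc.preimage (by fun_prop : Continuous
        fun p : (S × S) × (S × S) => (p.1.2, p.2.2)))
  refine ⟨t2_iff_isClosed_diagonal.mpr (hq₂.isClosed_preimage.mp hqc), ?_⟩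
  rw [(hq.prodMap_of_isClosed_ker hqc hq₂ hqc₂).continuous_iff]
  refine (hq.continuous.comp hm).congr fun p => ?_
  exact (hg p.1 p.2.1 p.2.2).symm
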